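/- Let {𝓗,Γ} be a B-generalized boundary pair for A*, let E be a densely defined symmetric operator in 𝓗, and let Γ̃ := {((f,f'),(h, Eh + h')) : ((f,f'),(h,h')) ∈ Γ, h ∈ dom E} be the associated AB-generalized boundary pair with Weyl function M̃(λ) = E + M(λ) on dom E. Then: (i) {𝓗,Γ̃} is a unitary boundary pair for A* if and only if E is selfadjoint; (ii) {𝓗,Γ̃} admits an extension to a unitary boundary pair for A* if and only if E has equal deficiency indices, i.e. dim ker(E*−i) = dim ker(E*+i), and in that case replacing E in the defining formula by any selfadjoint extension E₀ of E yields a unitary boundary pair extending Γ̃; (iii) {𝓗,Γ̃} is a B-generalized boundary pair for A* if and only if E is bounded and everywhere defined (hence selfadjoint); (iv) {𝓗,Γ̃} is an ordinary boundary triple for A* if and only if ran Γ̃ = 𝓗×𝓗, equivalently, if and only if ran Γ̃ is closed, E is bounded, and for λ ∈ ℂ∖ℝ the only h ∈ dom M̃(λ) with ⟨M̃(λ)h,h⟩ = ⟨h,M̃(λ)h⟩ is h = 0. -/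

import Mathlib

noncomputable section

open Filter Topology

namespace BT

local notation "⟪" x ", " y "⟫" => @inner ℂ _ _ x y

section Ops
variable {α β γ' : Type*}

def domR (T : Set (α × β)) : Set α := {x | ∃ y, (x, y) ∈ T}
def ranR (T : Set (α × β)) : Set β := {y | ∃ x, (x, y) ∈ T}
def kerR [Zero β] (T : Set (α × β)) : Set α := {x | (x, (0 : β)) ∈ T}
def mulR [Zero α] (T : Set (α × β)) : Set β := {y | ((0 : α), y) ∈ T}
def invR (T : Set (α × β)) : Set (β × α) := {p | (p.2, p.1) ∈ T}
def compR (T₂ : Set (β × γ')) (T₁ : Set (α × β)) : Set (α × γ') :=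
  {p | ∃ y, (p.1, y) ∈ T₁ ∧ (y, p.2) ∈ T₂}
def csum [Add α] [Add β] (T₁ T₂ : Set (α × β)) : Set (α × β) :=
  {p | ∃ q ∈ T₁, ∃ r ∈ T₂, p = (q.1 + r.1, q.2 + r.2)}

def IsLinRel {M : Type*} [AddCommGroup M] [Module ℂ M] (s : Set M) : Prop :=
  ∃ p : Submodule ℂ M, (p : Set M) = s

def IsBddRel [Norm α] [Norm β] (T : Set (α × β)) : Prop :=
  ∃ C : ℝ, ∀ p ∈ T, ‖p.2‖ ≤ C * ‖p.1‖

def BddInv [NormedAddCommGroup α] (T : Set (α × α)) : Prop :=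
  (∀ v, ∃ p ∈ T, p.2 = v) ∧ (∀ p ∈ T, ∀ q ∈ T, p.2 = q.2 → p.1 = q.1) ∧
    ∃ C : ℝ, ∀ p ∈ T, ‖p.1‖ ≤ C * ‖p.2‖
end Ops

section Shifts
variable {α : Type*} [AddCommGroup α] [Module ℂ α]

def shiftSub (T : Set (α × α)) (l : ℂ) : Set (α × α) :=
  {p | ∃ q ∈ T, p = (q.1, q.2 - l • q.1)}
def shiftAdd (T : Set (α × α)) (l : ℂ) : Set (α × α) :=
  {p | ∃ q ∈ T, p = (q.1, q.2 + l • q.1)}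
def hatN (T : Set (α × α)) (l : ℂ) : Set (α × α) := {p ∈ T | p.2 = l • p.1}
def Nlam (T : Set (α × α)) (l : ℂ) : Set α := {f | (f, l • f) ∈ T}
def Hrel (A0s : Set (α × α)) (l : ℂ) : Set (α × (α × α)) :=
  {q | q.2 ∈ A0s ∧ q.2.2 - l • q.2.1 = q.1}
end Shifts

section InnerDefs
variable {E F : Type*} [NormedAddCommGroup E] [InnerProductSpace ℂ E]
  [NormedAddCommGroup F] [InnerProductSpace ℂ F]

def adjR (S : Set (F × E)) : Set (E × F) :=
  {p | ∀ q ∈ S, ⟪p.1, q.2⟫ = ⟪p.2, q.1⟫}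

def IsClosedSymRel (A : Set (E × E)) : Prop :=
  IsLinRel A ∧ IsClosed A ∧ A ⊆ adjR A

def kIP (p q : E × E) : ℂ := -Complex.I * ⟪q.1, p.2⟫ + Complex.I * ⟪q.2, p.1⟫

def kreinOrth (S : Set (E × E)) : Set (E × E) := {v | ∀ u ∈ S, kIP u v = 0}

def GreenPair (Γ : Set ((E × E) × (F × F))) : Prop :=
  ∀ p ∈ Γ, ∀ q ∈ Γ,
    ⟪q.1.1, p.1.2⟫ - ⟪q.1.2, p.1.1⟫ = ⟪q.2.1, p.2.2⟫ - ⟪q.2.2, p.2.1⟫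

def G0 (Γ : Set ((E × E) × (F × F))) : Set ((E × E) × F) := {p | ∃ h', (p.1, (p.2, h')) ∈ Γ}
def G1 (Γ : Set ((E × E) × (F × F))) : Set ((E × E) × F) := {p | ∃ h, (p.1, (h, p.2)) ∈ Γ}
def A0 (Γ : Set ((E × E) × (F × F))) : Set (E × E) := kerR (G0 Γ)
def A1 (Γ : Set ((E × E) × (F × F))) : Set (E × E) := kerR (G1 Γ)
def weyl (Γ : Set ((E × E) × (F × F))) (l : ℂ) : Set (F × F) :=
  {p | ∃ f : E, ((f, l • f), p) ∈ Γ}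
def gfield (Γ : Set ((E × E) × (F × F))) (l : ℂ) : Set (F × E) :=
  {p | ∃ h', ((p.2, l • p.2), (p.1, h')) ∈ Γ}

def kreinAdj (Γ : Set ((E × E) × (F × F))) : Set ((F × F) × (E × E)) :=
  {q | ∀ p ∈ Γ, kIP p.1 q.2 = kIP p.2 q.1}

def IsIsomPair (A : Set (E × E)) (Γ : Set ((E × E) × (F × F))) : Prop :=
  IsLinRel Γ ∧ domR Γ ⊆ adjR A ∧ GreenPair Γ
def IsDomDense (A : Set (E × E)) (Γ : Set ((E × E) × (F × F))) : Prop :=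
  closure (domR Γ) = adjR A
def IsABPair (A : Set (E × E)) (Γ : Set ((E × E) × (F × F))) : Prop :=
  IsIsomPair A Γ ∧ IsDomDense A Γ ∧ Dense (ranR (G0 Γ)) ∧ A0 Γ = adjR (A0 Γ)
def IsBPair (A : Set (E × E)) (Γ : Set ((E × E) × (F × F))) : Prop :=
  IsABPair A Γ ∧ ranR (G0 Γ) = Set.univ
def IsUnitaryPair (A : Set (E × E)) (Γ : Set ((E × E) × (F × F))) : Prop :=
  GreenPair Γ ∧ domR Γ ⊆ adjR A ∧ IsDomDense A Γ ∧ invR Γ = kreinAdj Γ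
def IsUnitaryBT (A : Set (E × E)) (Γ : Set ((E × E) × (F × F))) : Prop :=
  IsUnitaryPair A Γ ∧ mulR Γ = {0}
def IsOrdinaryBT (A : Set (E × E)) (Γ : Set ((E × E) × (F × F))) : Prop :=
  IsIsomPair A Γ ∧ mulR Γ = {0} ∧ domR Γ = adjR A ∧ ranR Γ = Set.univ

def Erel (Γ : Set ((E × E) × (F × F))) (m : ℂ) : Set (F × F) :=
  {p | ∃ u' v', (p.1, u') ∈ weyl Γ m ∧ (p.1, v') ∈ weyl Γ ((starRingEnd ℂ) m) ∧
        p.2 = (2 : ℂ)⁻¹ • (u' + v')}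

def triTransform (Γ : Set ((E × E) × (F × F))) (e : Set (F × F)) :
    Set ((E × E) × (F × F)) :=
  {q | ∃ h h' w, (q.1, (h, h')) ∈ Γ ∧ (h, w) ∈ e ∧ q.2 = (h, w + h')}

def formVal (l : ℂ) (u u' : F) : ℝ :=
  ((l - (starRingEnd ℂ) l)⁻¹ * (⟪u, u'⟫ - ⟪u', u⟫)).re

def FormClosable (l : ℂ) (Ms : Set (F × F)) : Prop :=
  ∀ u u' : ℕ → F, (∀ n, (u n, u' n) ∈ Ms) →
    Tendsto u atTop (nhds (0 : F)) →
    Tendsto (fun nm : ℕ × ℕ => formVal l (u nm.1 - u nm.2) (u' nm.1 - u' nm.2)) atTop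
      (nhds (0 : ℝ)) →
    Tendsto (fun n => formVal l (u n) (u' n)) atTop (nhds (0 : ℝ))

def formClosureDom (l : ℂ) (Ms : Set (F × F)) : Set F :=
  {v | ∃ u u' : ℕ → F, (∀ n, (u n, u' n) ∈ Ms) ∧ Tendsto u atTop (nhds v) ∧
    Tendsto (fun nm : ℕ × ℕ => formVal l (u nm.1 - u nm.2) (u' nm.1 - u' nm.2)) atTop
      (nhds (0 : ℝ))}

end InnerDefs

section CompleteDefs
variable {F : Type*} [NormedAddCommGroup F] [InnerProductSpace ℂ F] [CompleteSpace F]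

def IsNevFun (M₀ : ℂ → F →L[ℂ] F) : Prop :=
  DifferentiableOn ℂ M₀ {l : ℂ | l.im ≠ 0} ∧
  (∀ l : ℂ, l.im ≠ 0 → M₀ ((starRingEnd ℂ) l) = ContinuousLinearMap.adjoint (M₀ l)) ∧
  (∀ l : ℂ, 0 < l.im → ∀ u, 0 ≤ (⟪u, M₀ l u⟫).im)

def ImOp (Tb : F →L[ℂ] F) : F →L[ℂ] F :=
  ((2 : ℂ) * Complex.I)⁻¹ • (Tb - ContinuousLinearMap.adjoint Tb)

end CompleteDefs

section Defect
variable {F : Type*} [NormedAddCommGroup F] [InnerProductSpace ℂ F]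

/-- The defect subspace `ker (E* − conj c)` of a symmetric relation `e` ⊆ F × F, realized
as `{h : (h, c • h) ∈ adjR e}`. -/
def defectSubmodule (e : Set (F × F)) (c : ℂ) : Submodule ℂ F where
  carrier := {h : F | (h, c • h) ∈ adjR e}
  zero_mem' := by
    intro q hq
    simp [adjR]
  add_mem' := by
    intro a b ha hb q hq
    have ha' := ha q hq
    have hb' := hb q hq
    simp only at ha' hb' ⊢
    simp [inner_add_left, smul_add, ha', hb']
  smul_mem' := by
    intro t x hx q hq
    have hx' := hx q hq
    simp only at hx' ⊢
    show ⟪t • x, q.2⟫ = ⟪c • t • x, q.1⟫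
    rw [smul_comm c t x, inner_smul_left, inner_smul_left, hx']
end Defect

variable {E F : Type*} [NormedAddCommGroup E] [InnerProductSpace ℂ E] [CompleteSpace E]
  [NormedAddCommGroup F] [InnerProductSpace ℂ F] [CompleteSpace F]


set_option linter.unusedSectionVars false

theorem mem_kreinAdj_iff (Γ : Set ((E × E) × (F × F))) (q : (F × F) × (E × E)) :
    q ∈ kreinAdj Γ ↔ ∀ p ∈ Γ, ⟪q.2.1, p.1.2⟫ - ⟪q.2.2, p.1.1⟫ =
      ⟪q.1.1, p.2.2⟫ - ⟪q.1.2, p.2.1⟫ := by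
  have hI : Complex.I ≠ 0 := Complex.I_ne_zero
  refine forall₂_congr fun p _ => ?_
  unfold kIP
  constructor
  · intro h
    apply mul_left_cancel₀ hI
    linear_combination -h
  · intro h
    linear_combination -Complex.I * h

theorem adjR_linear (S : Set (F × E)) : IsLinRel (adjR S) := by
  refine ⟨{ carrier := adjR S, zero_mem' := ?_, add_mem' := ?_, smul_mem' := ?_ }, rfl⟩
  · intro a b ha hb q hq
    have h1 := ha q hq
    have h2 := hb q hq
    simp [inner_add_left, h1, h2]
  · intro q hq
    simp
  · intro c x hx q hq
    have h1 := hx q hq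
    simp [inner_smul_left, h1]

theorem adjR_closed (S : Set (F × E)) : IsClosed (adjR S) := by
  have : adjR S = ⋂ q ∈ S, {p : E × F | ⟪p.1, q.2⟫ = ⟪p.2, q.1⟫} := by
    ext p; simp [adjR]
  rw [this]
  refine isClosed_biInter fun q _ => isClosed_eq ?_ ?_ <;> fun_prop

theorem adjR_anti {S T : Set (F × E)} (h : S ⊆ T) : adjR T ⊆ adjR S :=
  fun _ hp q hq => hp q (h hq)

theorem kreinAdj_closed (Γ : Set ((E × E) × (F × F))) : IsClosed (kreinAdj Γ) := by
  have : kreinAdj Γ = ⋂ p ∈ Γ, {q : (F × F) × (E × E) | kIP p.1 q.2 = kIP p.2 q.1} := by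
    ext p; simp [kreinAdj]
  rw [this]
  refine isClosed_biInter fun q _ => isClosed_eq ?_ ?_ <;> unfold kIP <;> fun_prop

theorem kreinAdj_linear (Γ : Set ((E × E) × (F × F))) : IsLinRel (kreinAdj Γ) := by
  refine ⟨{ carrier := kreinAdj Γ, zero_mem' := ?_, add_mem' := ?_, smul_mem' := ?_ }, rfl⟩
  · intro a b ha hb
    rw [mem_kreinAdj_iff] at *
    intro p hp
    have h1 := ha p hp
    have h2 := hb p hp
    simp only [Prod.fst_add, Prod.snd_add, inner_add_left]
    linear_combination h1 + h2
  · rw [mem_kreinAdj_iff]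
    intro q hq
    simp
  · intro c x hx
    rw [mem_kreinAdj_iff] at *
    intro p hp
    have h1 := hx p hp
    simp only [Prod.smul_fst, Prod.smul_snd, inner_smul_left]
    linear_combination (starRingEnd ℂ) c * h1

/-- the operator sending a pair to its second entry minus c times the first -/
def shiftL (c : ℂ) : (F × F) →L[ℂ] F :=
  ContinuousLinearMap.snd ℂ F F - c • ContinuousLinearMap.fst ℂ F F

theorem shiftL_apply (c : ℂ) (p : F × F) : shiftL c p = p.2 - c • p.1 := rfl

theorem shiftL_inner {c : ℂ} (hc : c = Complex.I ∨ c = -Complex.I) {p q : F × F}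
    (h : ⟪p.1, q.2⟫ = ⟪p.2, q.1⟫) :
    ⟪shiftL c p, shiftL c q⟫ = ⟪p.1, q.1⟫ + ⟪p.2, q.2⟫ := by
  simp only [shiftL_apply, inner_sub_left, inner_sub_right, inner_smul_left, inner_smul_right]
  rcases hc with rfl | rfl <;> simp only [map_neg, Complex.conj_I]
  · linear_combination Complex.I * h - ⟪p.1, q.1⟫ * Complex.I_mul_I
  · linear_combination -Complex.I * h - ⟪p.1, q.1⟫ * Complex.I_mul_I

theorem shiftL_norm {c : ℂ} (hc : c = Complex.I ∨ c = -Complex.I) {p : F × F}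
    (h : ⟪p.1, p.2⟫ = ⟪p.2, p.1⟫) :
    ‖shiftL c p‖ ^ 2 = ‖p.1‖ ^ 2 + ‖p.2‖ ^ 2 := by
  have := shiftL_inner hc h
  simp only [inner_self_eq_norm_sq_to_K] at this
  exact_mod_cast this

theorem shiftL_lower {c : ℂ} (hc : c = Complex.I ∨ c = -Complex.I) {p : F × F}
    (h : ⟪p.1, p.2⟫ = ⟪p.2, p.1⟫) : ‖p‖ ≤ ‖shiftL c p‖ := by
  have := shiftL_norm hc h
  rw [Prod.norm_def]
  refine max_le ?_ ?_ <;> refine (fun h1 h2 => (sq_le_sq₀ (norm_nonneg _) h2).1 h1) ?_ (norm_nonneg _) <;>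
    nlinarith [sq_nonneg ‖p.1‖, sq_nonneg ‖p.2‖]

theorem shiftL_closed {c : ℂ} (hc : c = Complex.I ∨ c = -Complex.I)
    (T : Submodule ℂ (F × F)) (hcl : IsClosed (T : Set (F × F)))
    (hs : (T : Set (F × F)) ⊆ adjR (T : Set (F × F))) :
    IsClosed ((T.map (shiftL (F := F) c : (F × F) →ₗ[ℂ] F) : Submodule ℂ F) : Set F) := by
  haveI : CompleteSpace T := hcl.completeSpace_coe
  let L : T →L[ℂ] F := (shiftL c).comp T.subtypeL
  have hanti : AntilipschitzWith 1 L := by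
    refine AddMonoidHomClass.antilipschitz_of_bound L fun x => ?_
    have := shiftL_lower hc (p := (x : F × F)) (hs x.2 x x.2)
    simpa [L] using this
  have := hanti.isClosed_range L.uniformContinuous
  convert this using 1
  ext y
  simp [L]

theorem shiftL_orth {c : ℂ} (hc : c = Complex.I ∨ c = -Complex.I) (T : Submodule ℂ (F × F))
    (g : F) : g ∈ (T.map (shiftL (F := F) c : (F × F) →ₗ[ℂ] F))ᗮ ↔
      (g, (-c) • g) ∈ adjR (T : Set (F × F)) := by
  rw [Submodule.mem_orthogonal']
  have key : ∀ q : F × F, ⟪g, shiftL c q⟫ = ⟪g, q.2⟫ - ⟪(-c) • g, q.1⟫ := by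
    intro q
    rw [shiftL_apply, inner_sub_right, inner_smul_right, inner_smul_left]
    rcases hc with rfl | rfl <;> simp
  constructor
  · intro h q hq
    have := h (shiftL c q) ⟨q, hq, rfl⟩
    rw [key] at this
    exact sub_eq_zero.1 this
  · rintro h _ ⟨q, hq, rfl⟩
    have := h q hq
    change ⟪g, shiftL c q⟫ = 0
    rw [key]
    exact sub_eq_zero.2 this

theorem neg_c {c : ℂ} (hc : c = Complex.I ∨ c = -Complex.I) :
    -c = Complex.I ∨ -c = -Complex.I := by
  rcases hc with rfl | rfl <;> simp

theorem shiftL_surj {c : ℂ} (hc : c = Complex.I ∨ c = -Complex.I) (T : Submodule ℂ (F × F))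
    (hT : (T : Set (F × F)) = adjR (T : Set (F × F))) :
    T.map (shiftL (F := F) c : (F × F) →ₗ[ℂ] F) = ⊤ := by
  have hcl : IsClosed (T : Set (F × F)) := by rw [hT]; exact adjR_closed _
  have h1 := shiftL_closed hc T hcl hT.subset
  haveI : CompleteSpace (T.map (shiftL (F := F) c : (F × F) →ₗ[ℂ] F)) := h1.completeSpace_coe
  rw [← Submodule.orthogonal_eq_bot_iff, Submodule.eq_bot_iff]
  intro g hg
  rw [shiftL_orth hc] at hg
  have hs := hg
  rw [← hT] at hs
  have h2 := shiftL_lower (neg_c hc) (p := (g, (-c) • g)) (hg _ hs)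
  rw [shiftL_apply] at h2
  simp only [sub_self, norm_zero] at h2
  have := norm_eq_zero.1 (le_antisymm h2 (norm_nonneg _))
  simpa using congrArg Prod.fst this

theorem selfadj_of_surj (T : Submodule ℂ (F × F))
    (hs : (T : Set (F × F)) ⊆ adjR (T : Set (F × F)))
    (h1 : T.map (shiftL (F := F) Complex.I : (F × F) →ₗ[ℂ] F) = ⊤)
    (h2 : T.map (shiftL (F := F) (-Complex.I) : (F × F) →ₗ[ℂ] F) = ⊤) :
    (T : Set (F × F)) = adjR (T : Set (F × F)) := by
  refine hs.antisymm fun g hg => ?_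
  have : shiftL (-Complex.I) g ∈ T.map (shiftL (F := F) (-Complex.I) : (F × F) →ₗ[ℂ] F) := by
    rw [h2]; trivial
  obtain ⟨f, hf, hfg⟩ := this
  have hfg' : shiftL (-Complex.I) f = shiftL (-Complex.I) g := hfg
  obtain ⟨P, hP⟩ := adjR_linear (T : Set (F × F))
  have hd : g - f ∈ adjR (T : Set (F × F)) := by
    have a : f ∈ P := by rw [← SetLike.mem_coe, hP]; exact hs hf
    have b : g ∈ P := by rw [← SetLike.mem_coe, hP]; exact hg
    rw [← hP]; exact P.sub_mem b a
  have h0 : shiftL (-Complex.I) (g - f) = 0 := by rw [map_sub, hfg', sub_self]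
  rw [shiftL_apply, sub_eq_zero] at h0
  have hd' : ((g - f).1, (-Complex.I) • (g - f).1) ∈ adjR (T : Set (F × F)) := by
    rw [← h0]; exact hd
  rw [← shiftL_orth (Or.inl rfl), h1] at hd'
  have h3 : (g - f).1 = 0 := by simpa using hd'
  have h4 : (g - f).2 = 0 := by rw [h0, h3, smul_zero]
  have : g = f := sub_eq_zero.1 (Prod.ext h3 h4)
  rw [this]; exact hf

/-- bilinear identity behind the Cayley transform -/
theorem cayley_ident (p q : F × F) :
    ⟪shiftL (-Complex.I) p, shiftL (-Complex.I) q⟫ - ⟪shiftL Complex.I p, shiftL Complex.I q⟫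
      = 2 * Complex.I * (⟪p.2, q.1⟫ - ⟪p.1, q.2⟫) := by
  simp only [shiftL_apply, inner_sub_left, inner_sub_right, inner_smul_left, inner_smul_right,
    map_neg, Complex.conj_I]
  ring

theorem sym_of_cayley {p q : F × F}
    (h : ⟪shiftL (-Complex.I) p, shiftL (-Complex.I) q⟫
      = ⟪shiftL Complex.I p, shiftL Complex.I q⟫) : ⟪p.1, q.2⟫ = ⟪p.2, q.1⟫ := by
  have := cayley_ident p q
  rw [h, sub_self] at this
  have h2 : (2 : ℂ) * Complex.I ≠ 0 := by simp
  have h3 := (mul_eq_zero.1 this.symm).resolve_left h2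
  exact (sub_eq_zero.1 h3).symm

theorem cayley_of_sym {p q : F × F} (h : ⟪p.1, q.2⟫ = ⟪p.2, q.1⟫) :
    ⟪shiftL (-Complex.I) p, shiftL (-Complex.I) q⟫
      = ⟪shiftL Complex.I p, shiftL Complex.I q⟫ := by
  have := cayley_ident p q
  rw [h, sub_self, mul_zero] at this
  exact sub_eq_zero.1 this

theorem adjR_closure (S : Set (F × E)) : adjR (closure S) = adjR S := by
  refine (adjR_anti subset_closure).antisymm fun p hp => ?_
  have hcl : IsClosed {q : F × E | ⟪p.1, q.2⟫ = ⟪p.2, q.1⟫} :=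
    isClosed_eq (by fun_prop) (by fun_prop)
  intro q hq
  exact closure_minimal (fun q hq => hp q hq) hcl hq

theorem sa_ext_of_defect (T : Submodule ℂ (F × F))
    (hs : (T : Set (F × F)) ⊆ adjR (T : Set (F × F)))
    (V : (defectSubmodule (T : Set (F × F)) Complex.I) ≃ₗᵢ[ℂ]
      (defectSubmodule (T : Set (F × F)) (-Complex.I))) :
    ∃ e₀ : Set (F × F), (T : Set (F × F)) ⊆ e₀ ∧ e₀ = adjR e₀ := by
  have hcs : closure (T : Set (F × F)) ⊆ adjR (closure (T : Set (F × F))) := by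
    rw [adjR_closure]
    exact closure_minimal hs (adjR_closed _)
  set Tc := T.topologicalClosure with hTc
  have hTcc : (Tc : Set (F × F)) = closure (T : Set (F × F)) := rfl
  have hadj : adjR (Tc : Set (F × F)) = adjR (T : Set (F × F)) := by
    rw [hTcc, adjR_closure]
  have hcs' : (Tc : Set (F × F)) ⊆ adjR (Tc : Set (F × F)) := hcs
  have hcl : IsClosed (Tc : Set (F × F)) := isClosed_closure
  -- Cayley inverse
  let D : (defectSubmodule (T : Set (F × F)) Complex.I) →ₗ[ℂ] F × F :=
    LinearMap.prod
      ((2 * Complex.I)⁻¹ • ((defectSubmodule (T : Set (F × F)) Complex.I).subtype -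
        (defectSubmodule (T : Set (F × F)) (-Complex.I)).subtype ∘ₗ V.toLinearEquiv.toLinearMap))
      ((2 : ℂ)⁻¹ • ((defectSubmodule (T : Set (F × F)) Complex.I).subtype +
        (defectSubmodule (T : Set (F × F)) (-Complex.I)).subtype ∘ₗ V.toLinearEquiv.toLinearMap))
  have hI2 : Complex.I * (2 * Complex.I)⁻¹ = (2 : ℂ)⁻¹ := by
    field_simp
  have hDp : ∀ u, shiftL (-Complex.I) (D u) = (u : F) := by
    intro u
    have e1 : (D u).1 = (2 * Complex.I)⁻¹ • ((u : F) - (V u : F)) := rfl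
    have e2 : (D u).2 = (2 : ℂ)⁻¹ • ((u : F) + (V u : F)) := rfl
    rw [shiftL_apply, e1, e2, smul_smul]
    rw [neg_mul, hI2]
    module
  have hDm : ∀ u, shiftL Complex.I (D u) = (V u : F) := by
    intro u
    have e1 : (D u).1 = (2 * Complex.I)⁻¹ • ((u : F) - (V u : F)) := rfl
    have e2 : (D u).2 = (2 : ℂ)⁻¹ • ((u : F) + (V u : F)) := rfl
    rw [shiftL_apply, e1, e2, smul_smul]
    rw [hI2]
    module
  have orthp : ∀ u : defectSubmodule (T : Set (F × F)) Complex.I, ∀ q ∈ Tc,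
      ⟪(u : F), shiftL (-Complex.I) q⟫ = 0 := by
    intro u q hq
    have h1 : ((u : F), (-(-Complex.I)) • (u : F)) ∈ adjR (Tc : Set (F × F)) := by
      rw [hadj, neg_neg]; exact u.2
    rw [← shiftL_orth (Or.inr rfl)] at h1
    exact (Submodule.mem_orthogonal' _ _).1 h1 _ ⟨q, hq, rfl⟩
  have orthm : ∀ u : defectSubmodule (T : Set (F × F)) (-Complex.I), ∀ q ∈ Tc,
      ⟪(u : F), shiftL (Complex.I) q⟫ = 0 := by
    intro u q hq
    have h1 : ((u : F), (-Complex.I) • (u : F)) ∈ adjR (Tc : Set (F × F)) := by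
      rw [hadj]; exact u.2
    rw [← shiftL_orth (Or.inl rfl)] at h1
    exact (Submodule.mem_orthogonal' _ _).1 h1 _ ⟨q, hq, rfl⟩
  let S : Submodule ℂ (F × F) := Tc ⊔ LinearMap.range D
  have hTS : Tc ≤ S := le_sup_left
  have hDS : ∀ u, D u ∈ S := fun u => (le_sup_right : _ ≤ S) ⟨u, rfl⟩
  refine ⟨S, fun p hp => hTS (T.le_topologicalClosure hp), selfadj_of_surj S ?_ ?_ ?_⟩
  · intro p hp q hq
    obtain ⟨a, ha, _, ⟨u, rfl⟩, rfl⟩ := Submodule.mem_sup.1 hp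
    obtain ⟨b, hb, _, ⟨v, rfl⟩, rfl⟩ := Submodule.mem_sup.1 hq
    apply sym_of_cayley
    simp only [map_add, inner_add_left, inner_add_right, hDp, hDm]
    have e1 := cayley_of_sym (hcs' ha b hb)
    have e2 : ⟪(u : F), (v : F)⟫ = ⟪(V u : F), (V v : F)⟫ := (V.inner_map_map u v).symm
    have e3 : ⟪shiftL (-Complex.I) a, (v : F)⟫ = 0 := by
      rw [← inner_conj_symm, orthp v a ha, map_zero]
    have e4 : ⟪shiftL Complex.I a, (V v : F)⟫ = 0 := by
      rw [← inner_conj_symm, orthm (V v) a ha, map_zero]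
    rw [e1, e2, e3, e4, orthp u b hb, orthm (V u) b hb]
  · have h1 := shiftL_closed (Or.inl rfl) Tc hcl hcs'
    haveI : CompleteSpace (Tc.map (shiftL (F := F) Complex.I : (F × F) →ₗ[ℂ] F)) := h1.completeSpace_coe
    rw [eq_top_iff, ← Submodule.sup_orthogonal_of_hasOrthogonalProjection
      (K := Tc.map (shiftL (F := F) Complex.I : (F × F) →ₗ[ℂ] F))]
    refine sup_le (Submodule.map_mono hTS) fun g hg => ?_
    rw [shiftL_orth (Or.inl rfl), hadj] at hg
    refine ⟨D (V.symm ⟨g, hg⟩), hDS _, ?_⟩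
    change shiftL Complex.I _ = _
    rw [hDm]; simp
  · have h1 := shiftL_closed (Or.inr rfl) Tc hcl hcs'
    haveI : CompleteSpace (Tc.map (shiftL (F := F) (-Complex.I) : (F × F) →ₗ[ℂ] F)) :=
      h1.completeSpace_coe
    rw [eq_top_iff, ← Submodule.sup_orthogonal_of_hasOrthogonalProjection
      (K := Tc.map (shiftL (F := F) (-Complex.I) : (F × F) →ₗ[ℂ] F))]
    refine sup_le (Submodule.map_mono hTS) fun g hg => ?_
    rw [shiftL_orth (Or.inr rfl), hadj, neg_neg] at hg
    refine ⟨D ⟨g, hg⟩, hDS _, ?_⟩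
    change shiftL (-Complex.I) _ = _
    rw [hDp]

theorem defect_of_sa_ext (T S : Submodule ℂ (F × F)) (hTS : T ≤ S)
    (hS : (S : Set (F × F)) = adjR (S : Set (F × F))) :
    Nonempty ((defectSubmodule (T : Set (F × F)) Complex.I) ≃ₗᵢ[ℂ]
      (defectSubmodule (T : Set (F × F)) (-Complex.I))) := by
  have hsym : ∀ x : S, ⟪(x : F × F).1, (x : F × F).2⟫ = ⟪(x : F × F).2, (x : F × F).1⟫ :=
    fun x => hS.subset x.2 x x.2
  have bij : ∀ c : ℂ, (c = Complex.I ∨ c = -Complex.I) →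
      Function.Bijective ((shiftL (F := F) c : (F × F) →ₗ[ℂ] F) ∘ₗ S.subtype) := by
    intro c hc
    constructor
    · rw [← LinearMap.ker_eq_bot, LinearMap.ker_eq_bot']
      intro x hx
      have hx' : shiftL c (x : F × F) = 0 := hx
      have := shiftL_lower hc (hsym x)
      rw [hx', norm_zero] at this
      exact Subtype.ext (norm_eq_zero.1 (le_antisymm this (norm_nonneg _)))
    · intro y
      have : y ∈ S.map (shiftL (F := F) c : (F × F) →ₗ[ℂ] F) := by
        rw [shiftL_surj hc S hS]; trivial
      obtain ⟨x, hx, rfl⟩ := this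
      exact ⟨⟨x, hx⟩, rfl⟩
  let Lp := LinearEquiv.ofBijective _ (bij (-Complex.I) (Or.inr rfl))
  let Lm := LinearEquiv.ofBijective _ (bij (Complex.I) (Or.inl rfl))
  have hLp : ∀ x : S, Lp x = shiftL (-Complex.I) (x : F × F) := fun _ => rfl
  have hLm : ∀ x : S, Lm x = shiftL (Complex.I) (x : F × F) := fun _ => rfl
  let U : F ≃ₗᵢ[ℂ] F := ⟨Lp.symm.trans Lm, by
    intro y
    obtain ⟨x, rfl⟩ := Lp.surjective y
    rw [LinearEquiv.trans_apply, LinearEquiv.symm_apply_apply, hLp, hLm]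
    have h1 := shiftL_norm (Or.inl rfl) (hsym x)
    have h2 := shiftL_norm (Or.inr rfl) (hsym x)
    rw [← h2] at h1
    exact (sq_eq_sq₀ (norm_nonneg _) (norm_nonneg _)).1 h1⟩
  have hU : ∀ x : S, U (shiftL (-Complex.I) (x : F × F)) = shiftL Complex.I (x : F × F) := by
    intro x
    change Lm (Lp.symm (Lp x)) = _
    rw [LinearEquiv.symm_apply_apply]; rfl
  have hmap : (defectSubmodule (T : Set (F × F)) Complex.I).map
      (U.toLinearEquiv : F →ₗ[ℂ] F) = defectSubmodule (T : Set (F × F)) (-Complex.I) := by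
    have key : ∀ g, g ∈ defectSubmodule (T : Set (F × F)) Complex.I ↔
        U g ∈ defectSubmodule (T : Set (F × F)) (-Complex.I) := by
      intro g
      have h1 := shiftL_orth (Or.inr rfl) T g
      have h2 := shiftL_orth (Or.inl rfl) T (U g)
      rw [neg_neg] at h1
      change (g, Complex.I • g) ∈ adjR (T : Set (F × F)) ↔
        (U g, (-Complex.I) • U g) ∈ adjR (T : Set (F × F))
      rw [← h1, ← h2, Submodule.mem_orthogonal', Submodule.mem_orthogonal']
      constructor
      · rintro h _ ⟨q, hq, rfl⟩
        have := h _ ⟨q, hq, rfl⟩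
        change ⟪U g, shiftL Complex.I q⟫ = 0
        rw [← hU ⟨q, hTS hq⟩, U.inner_map_map]
        exact this
      · rintro h _ ⟨q, hq, rfl⟩
        have := h _ ⟨q, hq, rfl⟩
        change ⟪U g, shiftL Complex.I q⟫ = 0 at this
        rw [← hU ⟨q, hTS hq⟩, U.inner_map_map] at this
        exact this
    ext g
    constructor
    · rintro ⟨x, hx, rfl⟩
      exact (key x).1 hx
    · intro hg
      refine ⟨U.symm g, (key _).2 ?_, ?_⟩
      · rw [U.apply_symm_apply]; exact hg
      · exact U.apply_symm_apply g
  exact ⟨(U.submoduleMap _).trans (LinearIsometryEquiv.ofEq _ _ hmap)⟩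

theorem mul_zero_of_ran (G : Submodule ℂ ((E × E) × (F × F)))
    (hG : GreenPair (G : Set ((E × E) × (F × F))))
    (hr : ranR (G0 (G : Set ((E × E) × (F × F)))) = Set.univ) {k : F}
    (hk : (((0, 0), (0, k)) : (E × E) × (F × F)) ∈ G) : k = 0 := by
  have : k ∈ ranR (G0 (G : Set ((E × E) × (F × F)))) := by rw [hr]; trivial
  obtain ⟨f, h', hf⟩ := this
  have := hG _ hf _ hk
  simp only [inner_zero_left, sub_zero, zero_sub] at this
  have h2 : ⟪k, k⟫ = 0 := by simpa using this
  exact inner_self_eq_zero.1 h2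

theorem kreinAdj_tri (G : Submodule ℂ ((E × E) × (F × F)))
    (hG : GreenPair (G : Set ((E × E) × (F × F))))
    (hr : ranR (G0 (G : Set ((E × E) × (F × F)))) = Set.univ)
    (hs : A0 (G : Set ((E × E) × (F × F))) = adjR (A0 (G : Set ((E × E) × (F × F)))))
    (e : Set (F × F)) (h0 : ((0, 0) : F × F) ∈ e) :
    kreinAdj (triTransform (G : Set ((E × E) × (F × F))) e) =
      invR (triTransform (G : Set ((E × E) × (F × F))) (adjR e)) := by
  ext ⟨⟨k, k2⟩, g⟩
  rw [mem_kreinAdj_iff]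
  constructor
  · intro H
    have : k ∈ ranR (G0 (G : Set ((E × E) × (F × F)))) := by rw [hr]; trivial
    obtain ⟨fk, k1, hfk⟩ := this
    simp only at hfk
    have key : ∀ f h h' w, (f, (h, h')) ∈ G → (h, w) ∈ e →
        ⟪g.1 - fk.1, f.2⟫ - ⟪g.2 - fk.2, f.1⟫ = ⟪k, w⟫ - ⟪k2 - k1, h⟫ := by
      intro f h h' w hf hw
      have a := H (f, (h, w + h')) ⟨h, h', w, hf, hw, rfl⟩
      have b := hG _ hf _ hfk
      simp only [inner_add_right, inner_sub_left] at a b ⊢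
      linear_combination a - b
    have hA0 : g - fk ∈ A0 (G : Set ((E × E) × (F × F))) := by
      rw [hs]
      rintro f ⟨h', hf⟩
      have := key f 0 h' 0 hf h0
      simp only [inner_zero_right, sub_zero] at this
      exact sub_eq_zero.1 this
    obtain ⟨k3, hk3⟩ := hA0
    simp only at hk3
    have hadd : (g, (k, k1 + k3)) ∈ G := by
      have := G.add_mem hfk hk3
      simpa using this
    refine ⟨k, k1 + k3, k2 - (k1 + k3), hadd, ?_, by simp⟩
    rintro ⟨h, w⟩ hw
    have : h ∈ ranR (G0 (G : Set ((E × E) × (F × F)))) := by rw [hr]; trivial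
    obtain ⟨f, h', hf⟩ := this
    have a := key f h h' w hf hw
    have b := hG _ hf _ hk3
    simp only [Prod.fst_sub, Prod.snd_sub, inner_zero_left, inner_sub_left,
      inner_add_left] at a b ⊢
    linear_combination b - a
  · rintro ⟨h, h', v, hg, hv, heq⟩
    simp only [Prod.mk.injEq] at heq
    obtain ⟨rfl, rfl⟩ := heq
    rintro ⟨f, _⟩ ⟨l, l', w, hf, hw, rfl⟩
    have a := hG _ hf _ hg
    have b := hv _ hw
    simp only [inner_add_left, inner_add_right] at a b ⊢
    linear_combination a - b

theorem tri_inj (G : Submodule ℂ ((E × E) × (F × F)))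
    (hG : GreenPair (G : Set ((E × E) × (F × F))))
    (hr : ranR (G0 (G : Set ((E × E) × (F × F)))) = Set.univ) {e₁ e₂ : Set (F × F)}
    (h : triTransform (G : Set ((E × E) × (F × F))) e₁ ⊆ triTransform G e₂) : e₁ ⊆ e₂ := by
  rintro ⟨k, v⟩ hv
  have : k ∈ ranR (G0 (G : Set ((E × E) × (F × F)))) := by rw [hr]; trivial
  obtain ⟨f, k', hf⟩ := this
  obtain ⟨h, h', w, h1, h2, h3⟩ := h (show (f, (k, v + k')) ∈ _ from ⟨k, k', v, hf, hv, rfl⟩)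
  simp only [Prod.mk.injEq] at h3
  obtain ⟨rfl, h3⟩ := h3
  have hd := G.sub_mem hf h1
  have : k' - h' = 0 := by
    apply mul_zero_of_ran G hG hr
    convert hd using 1
    simp
  have hk : k' = h' := sub_eq_zero.1 this
  rw [hk] at h3
  rw [add_right_cancel h3]
  exact h2

theorem tri_mono (Γ : Set ((E × E) × (F × F))) {e₁ e₂ : Set (F × F)} (h : e₁ ⊆ e₂) :
    triTransform Γ e₁ ⊆ triTransform Γ e₂ := by
  rintro p ⟨a, b, c, h1, h2, h3⟩
  exact ⟨a, b, c, h1, h h2, h3⟩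

theorem invR_inj {α β : Type*} {S T : Set (α × β)} (h : invR S = invR T) : S = T := by
  ext ⟨a, b⟩
  exact Set.ext_iff.1 h (b, a)

theorem mul_of_sym {e : Set (F × F)} (he2 : Dense (domR e)) {w : F}
    (hw : ((0 : F), w) ∈ adjR e) : w = 0 := by
  refine he2.eq_zero_of_inner_right (𝕜 := ℂ) ?_
  rintro v ⟨v', hv⟩
  have := hw _ hv
  simp only [inner_zero_left] at this
  rw [← inner_conj_symm, ← this, map_zero]

theorem unitary_base (G : Submodule ℂ ((E × E) × (F × F)))
    (hG : GreenPair (G : Set ((E × E) × (F × F))))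
    (hr : ranR (G0 (G : Set ((E × E) × (F × F)))) = Set.univ)
    (hs : A0 (G : Set ((E × E) × (F × F))) = adjR (A0 (G : Set ((E × E) × (F × F))))) :
    IsClosed (G : Set ((E × E) × (F × F))) := by
  have h := kreinAdj_tri G hG hr hs {p : F × F | p.2 = 0} rfl
  have had : adjR {p : F × F | p.2 = 0} = {p : F × F | p.2 = 0} := by
    ext ⟨a, b⟩
    constructor
    · intro hp
      have := hp (b, 0) rfl
      simp only [inner_zero_right] at this
      exact inner_self_eq_zero.1 this.symm
    · intro hb q hq
      have h1 : q.2 = 0 := hq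
      have h2 : b = 0 := hb
      simp [h1, h2]
  have ht : triTransform (G : Set ((E × E) × (F × F))) {p : F × F | p.2 = 0} = G := by
    ext ⟨f, k, k'⟩
    constructor
    · rintro ⟨h, h', w, h1, h2, h3⟩
      have h2' : w = 0 := h2
      subst h2'
      simp only [zero_add] at h3
      rw [h3]; exact h1
    · intro hp
      exact ⟨k, k', 0, hp, rfl, by simp⟩
  rw [had, ht] at h
  have hc := kreinAdj_closed (G : Set ((E × E) × (F × F)))
  rw [h] at hc
  exact hc.preimage continuous_swap

theorem gamma_exists (G : Submodule ℂ ((E × E) × (F × F)))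
    (hG : GreenPair (G : Set ((E × E) × (F × F))))
    (hr : ranR (G0 (G : Set ((E × E) × (F × F)))) = Set.univ)
    (hs : A0 (G : Set ((E × E) × (F × F))) = adjR (A0 (G : Set ((E × E) × (F × F))))) :
    ∃ Φ : F →L[ℂ] (E × F), ∀ h, (((Φ h).1, Complex.I • (Φ h).1), (h, (Φ h).2)) ∈ G := by
  have hcl := unitary_base G hG hr hs
  let J : (F × (E × F)) →L[ℂ] ((E × E) × (F × F)) :=
    let f := (ContinuousLinearMap.fst ℂ E F).comp (ContinuousLinearMap.snd ℂ F (E × F))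
    let m := (ContinuousLinearMap.snd ℂ E F).comp (ContinuousLinearMap.snd ℂ F (E × F))
    let h := ContinuousLinearMap.fst ℂ F (E × F)
    (f.prod (Complex.I • f)).prod (h.prod m)
  have hJ : ∀ x, J x = ((x.2.1, Complex.I • x.2.1), (x.1, x.2.2)) := fun _ => rfl
  let K : Submodule ℂ (F × (E × F)) := G.comap (J : (F × (E × F)) →ₗ[ℂ] ((E × E) × (F × F)))
  have hK : ∀ x, x ∈ K ↔ ((x.2.1, Complex.I • x.2.1), (x.1, x.2.2)) ∈ G := fun _ => Iff.rfl
  have hKcl : IsClosed (K : Set (F × (E × F))) := hcl.preimage J.continuous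
  haveI : CompleteSpace K := hKcl.completeSpace_coe
  obtain ⟨T, hT⟩ := adjR_linear (A0 (G : Set ((E × E) × (F × F))))
  rw [← hs] at hT
  have hTs : (T : Set (E × E)) = adjR (T : Set (E × E)) := by rw [hT]; exact hs
  let L : K →L[ℂ] F := (ContinuousLinearMap.fst ℂ F (E × F)).comp K.subtypeL
  have hL : ∀ x : K, L x = (x : F × (E × F)).1 := fun _ => rfl
  have hker : LinearMap.ker (L : K →ₗ[ℂ] F) = ⊥ := by
    rw [LinearMap.ker_eq_bot']
    rintro ⟨⟨h, f, m⟩, hx⟩ h0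
    have h0' : h = 0 := h0
    subst h0'
    rw [hK] at hx
    simp only at hx
    have hf : (f, Complex.I • f) ∈ (T : Set (E × E)) := by rw [hT]; exact ⟨m, hx⟩
    have hl := shiftL_lower (Or.inl rfl) (hTs.subset hf _ hf)
    rw [shiftL_apply] at hl
    simp only [sub_self, norm_zero] at hl
    have hf0 : f = 0 := congrArg Prod.fst (norm_eq_zero.1 (le_antisymm hl (norm_nonneg _)))
    subst hf0
    rw [smul_zero] at hx
    have hm := mul_zero_of_ran G hG hr hx
    subst hm
    rfl
  have hrange : LinearMap.range (L : K →ₗ[ℂ] F) = ⊤ := by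
    rw [LinearMap.range_eq_top]
    intro h
    have : h ∈ ranR (G0 (G : Set ((E × E) × (F × F)))) := by rw [hr]; trivial
    obtain ⟨f, h', hf⟩ := this
    simp only at hf
    have : shiftL Complex.I f ∈ T.map (shiftL (F := E) Complex.I : (E × E) →ₗ[ℂ] E) := by
      rw [shiftL_surj (Or.inl rfl) T hTs]; trivial
    obtain ⟨a, ha, haf⟩ := this
    have haf' : shiftL Complex.I a = shiftL Complex.I f := haf
    rw [hT] at ha
    obtain ⟨m, hm⟩ := ha
    simp only at hm
    have hd := G.sub_mem hf hm
    have h2 : (f - a).2 = Complex.I • (f - a).1 := by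
      have : shiftL Complex.I (f - a) = 0 := by rw [map_sub, haf', sub_self]
      rw [shiftL_apply] at this
      exact sub_eq_zero.1 this
    refine ⟨⟨(h, ((f - a).1, h' - m)), ?_⟩, rfl⟩
    rw [hK]
    simp only
    rw [← h2]
    have e0 : h = h - 0 := (sub_zero h).symm
    rw [e0]
    exact hd
  let Q := ContinuousLinearEquiv.ofBijective L hker hrange
  refine ⟨(ContinuousLinearMap.snd ℂ F (E × F)).comp (K.subtypeL.comp
    (Q.symm : F →L[ℂ] K)), fun h => ?_⟩
  have h1 : ((Q.symm h : K) : F × (E × F)).1 = h := Q.apply_symm_apply h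
  have h2 := (hK _).1 (Q.symm h).2
  rw [h1] at h2
  exact h2

theorem tri_dense (A : Set (E × E)) (G : Submodule ℂ ((E × E) × (F × F)))
    (hB : IsBPair A (G : Set ((E × E) × (F × F)))) (e : Set (F × F)) (he : Dense (domR e)) :
    domR (triTransform (G : Set ((E × E) × (F × F))) e) ⊆ adjR A ∧
      IsDomDense A (triTransform (G : Set ((E × E) × (F × F))) e) := by
  obtain ⟨⟨⟨-, hdom, hG⟩, hD, -, hs⟩, hr⟩ := hB
  obtain ⟨Φ, hΦ⟩ := gamma_exists G hG hr hs
  have hsub : domR (triTransform (G : Set ((E × E) × (F × F))) e) ⊆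
      domR (G : Set ((E × E) × (F × F))) := by
    rintro f ⟨_, h, h', w, hf, -, -⟩
    exact ⟨_, hf⟩
  refine ⟨hsub.trans hdom, ?_⟩
  unfold IsDomDense at hD ⊢
  rw [← hD]
  refine (closure_mono hsub).antisymm (closure_minimal ?_ isClosed_closure)
  rintro f ⟨⟨h, h'⟩, hf⟩
  let φ : F → E × E := fun k =>
    f - ((Φ h).1, Complex.I • (Φ h).1) + ((Φ k).1, Complex.I • (Φ k).1)
  have hφ : Continuous φ := by fun_prop
  have hφh : φ h = f := by simp [φ]
  rw [← hφh]
  refine map_mem_closure hφ (he h) ?_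
  rintro k ⟨w, hk⟩
  have h1 := G.add_mem (G.sub_mem hf (hΦ h)) (hΦ k)
  refine ⟨(k, w + (h' - (Φ h).2 + (Φ k).2)), k, _, w, ?_, hk, rfl⟩
  simpa [φ] using h1

theorem tri_green (Γ : Set ((E × E) × (F × F))) (hG : GreenPair Γ) (e : Set (F × F))
    (he : e ⊆ adjR e) : GreenPair (triTransform Γ e) := by
  rintro ⟨f, _⟩ ⟨h, h', w, hf, hw, rfl⟩ ⟨g, _⟩ ⟨k, k', v, hg, hv, rfl⟩
  have a := hG _ hf _ hg
  have b := he hv _ hw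
  simp only [inner_add_left, inner_add_right] at a b ⊢
  linear_combination a - b

theorem tri_linear (G : Submodule ℂ ((E × E) × (F × F))) (e : Submodule ℂ (F × F)) :
    IsLinRel (triTransform (G : Set ((E × E) × (F × F))) (e : Set (F × F))) := by
  refine ⟨{ carrier := triTransform (G : Set ((E × E) × (F × F))) (e : Set (F × F)),
            zero_mem' := ?_, add_mem' := ?_, smul_mem' := ?_ }, rfl⟩
  · rintro ⟨f, _⟩ ⟨g, _⟩ ⟨h, h', w, hf, hw, rfl⟩ ⟨k, k', v, hg, hv, rfl⟩
    refine ⟨h + k, h' + k', w + v, G.add_mem hf hg, e.add_mem hw hv, ?_⟩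
    simp only [Prod.mk_add_mk]
    congr 1
    abel
  · exact ⟨0, 0, 0, G.zero_mem, e.zero_mem, by simp; rfl⟩
  · rintro c ⟨f, _⟩ ⟨h, h', w, hf, hw, rfl⟩
    refine ⟨c • h, c • h', c • w, G.smul_mem c hf, e.smul_mem c hw, ?_⟩
    simp

theorem unitary_tri_iff (A : Set (E × E)) (G : Submodule ℂ ((E × E) × (F × F)))
    (hB : IsBPair A (G : Set ((E × E) × (F × F)))) (e : Set (F × F)) (he1 : IsLinRel e)
    (he2 : Dense (domR e)) (he3 : e ⊆ adjR e) :
    IsUnitaryPair A (triTransform (G : Set ((E × E) × (F × F))) e) ↔ e = adjR e := by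
  obtain ⟨hd1, hd2⟩ := tri_dense A G hB e he2
  obtain ⟨⟨⟨-, hdom, hG⟩, hD, -, hs⟩, hr⟩ := hB
  have h0 : ((0, 0) : F × F) ∈ e := by
    obtain ⟨T, rfl⟩ := he1
    exact T.zero_mem
  have hk := kreinAdj_tri G hG hr hs e h0
  constructor
  · rintro ⟨-, -, -, hu⟩
    rw [hk] at hu
    exact (tri_inj G hG hr (invR_inj hu).subset).antisymm (tri_inj G hG hr (invR_inj hu).superset)
  · intro h
    refine ⟨tri_green _ hG e he3, hd1, hd2, ?_⟩
    rw [hk, ← h]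

theorem sa_of_unitary_ext (A : Set (E × E)) (G : Submodule ℂ ((E × E) × (F × F)))
    (hB : IsBPair A (G : Set ((E × E) × (F × F)))) (e : Set (F × F)) (he1 : IsLinRel e)
    (Γ' : Set ((E × E) × (F × F))) (hu : IsUnitaryPair A Γ')
    (hsub : triTransform (G : Set ((E × E) × (F × F))) e ⊆ Γ') :
    ∃ e₀ : Set (F × F), e ⊆ e₀ ∧ e₀ = adjR e₀ := by
  obtain ⟨⟨⟨-, hdom, hG⟩, hD, -, hs⟩, hr⟩ := hB
  obtain ⟨-, -, -, hu⟩ := hu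
  have h0 : ((0, 0) : F × F) ∈ e := by
    obtain ⟨T, rfl⟩ := he1
    exact T.zero_mem
  have hk := kreinAdj_tri G hG hr hs e h0
  obtain ⟨P, hP⟩ := kreinAdj_linear Γ'
  rw [← hu] at hP
  have hmem : ∀ x y, (x, y) ∈ Γ' ↔ (y, x) ∈ P := by
    intro x y
    rw [← SetLike.mem_coe, hP]
    rfl
  have hup : Γ' ⊆ triTransform (G : Set ((E × E) × (F × F))) (adjR e) := by
    rintro ⟨x, y⟩ hxy
    have h1 : (y, x) ∈ kreinAdj Γ' := by rw [← hu]; exact hxy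
    have h2 : (y, x) ∈ kreinAdj (triTransform (G : Set ((E × E) × (F × F))) e) :=
      fun p hp => h1 p (hsub hp)
    rw [hk] at h2
    exact h2
  let e₀ : Set (F × F) := {p | ∃ f h', (f, (p.1, h')) ∈ G ∧ (f, (p.1, p.2 + h')) ∈ Γ'}
  have hee : e ⊆ e₀ := by
    rintro ⟨h, w⟩ hw
    have : h ∈ ranR (G0 (G : Set ((E × E) × (F × F)))) := by rw [hr]; trivial
    obtain ⟨f, h', hf⟩ := this
    exact ⟨f, h', hf, hsub ⟨h, h', w, hf, hw, rfl⟩⟩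
  have ht : triTransform (G : Set ((E × E) × (F × F))) e₀ = Γ' := by
    apply Set.Subset.antisymm
    · rintro ⟨f, _⟩ ⟨h, h', w, hf, ⟨g, k', hg, hg'⟩, rfl⟩
      simp only at hf hg hg'
      have hd := G.sub_mem hf hg
      have hd' : (f - g, ((0 : F), 0 + (h' - k'))) ∈ Γ' :=
        hsub ⟨0, h' - k', 0, by simpa using hd, h0, rfl⟩
      rw [hmem] at hd' hg' ⊢
      have := P.add_mem hd' hg'
      convert this using 1
      simp only [Prod.mk_add_mk, zero_add, sub_add_cancel]
      congr 2
      abel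
    · rintro ⟨f, k⟩ hf
      obtain ⟨h, h', w, h1, h2, h3⟩ := hup hf
      simp only at h1 h3
      subst h3
      exact ⟨h, h', w, h1, ⟨f, h', h1, hf⟩, rfl⟩
  have hk0 := kreinAdj_tri G hG hr hs e₀ (hee h0)
  rw [ht, ← hu] at hk0
  have h3 := invR_inj hk0
  rw [← ht] at h3
  exact ⟨e₀, hee, (tri_inj G hG hr h3.subset).antisymm (tri_inj G hG hr h3.superset)⟩

theorem sa_of_full {e : Set (F × F)} (he3 : e ⊆ adjR e) (hd : domR e = Set.univ) :
    e = adjR e := by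
  refine he3.antisymm ?_
  rintro ⟨k, v⟩ hv
  have : k ∈ domR e := by rw [hd]; trivial
  obtain ⟨w, hw⟩ := this
  obtain ⟨P, hP⟩ := adjR_linear e
  have h1 : (k, v) - (k, w) ∈ P :=
    P.sub_mem (by rw [← SetLike.mem_coe, hP]; exact hv) (by rw [← SetLike.mem_coe, hP]; exact he3 hw)
  rw [← SetLike.mem_coe, hP] at h1
  have h2 : ((0 : F), v - w) ∈ adjR e := by simpa using h1
  have := mul_of_sym (by rw [hd]; exact dense_univ) h2
  rw [sub_eq_zero.1 this]
  exact hw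

theorem bdd_of_full (T : Submodule ℂ (F × F)) (he3 : (T : Set (F × F)) ⊆ adjR (T : Set (F × F)))
    (hd : domR (T : Set (F × F)) = Set.univ) : IsBddRel (T : Set (F × F)) := by
  have hsa := sa_of_full he3 hd
  have hcl : IsClosed (T : Set (F × F)) := by rw [hsa]; exact adjR_closed _
  haveI : CompleteSpace T := hcl.completeSpace_coe
  let L : T →L[ℂ] F := (ContinuousLinearMap.fst ℂ F F).comp T.subtypeL
  have hker : LinearMap.ker (L : T →ₗ[ℂ] F) = ⊥ := by
    rw [LinearMap.ker_eq_bot']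
    rintro ⟨⟨h, w⟩, hx⟩ h0
    have h0' : h = 0 := h0
    subst h0'
    have := mul_of_sym (by rw [hd]; exact dense_univ) (he3 hx)
    subst this
    rfl
  have hrange : LinearMap.range (L : T →ₗ[ℂ] F) = ⊤ := by
    rw [LinearMap.range_eq_top]
    intro h
    have : h ∈ domR (T : Set (F × F)) := by rw [hd]; trivial
    obtain ⟨w, hw⟩ := this
    exact ⟨⟨(h, w), hw⟩, rfl⟩
  let Q := ContinuousLinearEquiv.ofBijective L hker hrange
  refine ⟨‖(Q.symm : F →L[ℂ] T)‖, fun p hp => ?_⟩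
  have h1 : Q.symm p.1 = ⟨p, hp⟩ := by
    rw [ContinuousLinearEquiv.symm_apply_eq]; rfl
  have h2 := (Q.symm : F →L[ℂ] T).le_opNorm p.1
  rw [ContinuousLinearEquiv.coe_coe, h1] at h2
  exact (norm_snd_le p).trans h2

theorem tri_ran0 (Γ : Set ((E × E) × (F × F))) (hr : ranR (G0 Γ) = Set.univ) (e : Set (F × F)) :
    ranR (G0 (triTransform Γ e)) = domR e := by
  ext h
  constructor
  · rintro ⟨f, k', k, h', w, -, hw, heq⟩
    simp only [Prod.mk.injEq] at heq
    rw [heq.1]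
    exact ⟨w, hw⟩
  · rintro ⟨w, hw⟩
    have : h ∈ ranR (G0 Γ) := by rw [hr]; trivial
    obtain ⟨f, h', hf⟩ := this
    exact ⟨f, w + h', h, h', w, hf, hw, rfl⟩

theorem tri_A0 (Γ : Set ((E × E) × (F × F))) (e : Set (F × F)) (h0 : ((0, 0) : F × F) ∈ e)
    (he2 : Dense (domR e)) (he3 : e ⊆ adjR e) :
    A0 (triTransform Γ e) = A0 Γ := by
  ext f
  constructor
  · rintro ⟨k', k, h', w, hf, hw, heq⟩
    simp only [Prod.mk.injEq] at heq hf
    obtain ⟨rfl, rfl⟩ := heq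
    exact ⟨h', hf⟩
  · rintro ⟨h', hf⟩
    exact ⟨0 + h', 0, h', 0, hf, h0, rfl⟩

theorem ran_tri_dom (Γ : Set ((E × E) × (F × F))) (e : Set (F × F))
    (h : ranR (triTransform Γ e) = Set.univ) : domR e = Set.univ := by
  rw [Set.eq_univ_iff_forall]
  intro k
  have : (k, (0 : F)) ∈ ranR (triTransform Γ e) := by rw [h]; trivial
  obtain ⟨f, h, h', w, -, hw, heq⟩ := this
  simp only [Prod.mk.injEq] at heq
  rw [heq.1]
  exact ⟨w, hw⟩

theorem ordinary_of_ran (A : Set (E × E)) (G : Submodule ℂ ((E × E) × (F × F)))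
    (hu : IsUnitaryPair A (G : Set ((E × E) × (F × F))))
    (hran : ranR (G : Set ((E × E) × (F × F))) = Set.univ) :
    IsOrdinaryBT A (G : Set ((E × E) × (F × F))) := by
  obtain ⟨hG, hdom, hD, hk⟩ := hu
  have hcl : IsClosed (G : Set ((E × E) × (F × F))) := by
    have hc := kreinAdj_closed (G : Set ((E × E) × (F × F)))
    rw [← hk] at hc
    exact hc.preimage continuous_swap
  haveI : CompleteSpace G := hcl.completeSpace_coe
  let P : G →L[ℂ] (F × F) := (ContinuousLinearMap.snd ℂ (E × E) (F × F)).comp G.subtypeL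
  have hsurj : Function.Surjective P := by
    intro k
    have : k ∈ ranR (G : Set ((E × E) × (F × F))) := by rw [hran]; trivial
    obtain ⟨f, hf⟩ := this
    exact ⟨⟨(f, k), hf⟩, rfl⟩
  obtain ⟨C, hC, hpre⟩ := P.exists_preimage_norm_le hsurj
  have bound : ∀ x : G, ‖(x : (E × E) × (F × F)).2‖ ≤ 2 * C * ‖(x : (E × E) × (F × F)).1‖ := by
    rintro ⟨⟨f, h, h'⟩, hx⟩
    obtain ⟨⟨⟨g, k⟩, hy⟩, hy1, hy2⟩ := hpre (h', -h)
    have hk' : k = (h', -h) := hy1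
    subst hk'
    have hgn : ‖g‖ ≤ C * ‖(h, h')‖ := by
      have e1 : ‖((h', -h) : F × F)‖ = ‖((h, h') : F × F)‖ := by
        rw [Prod.norm_def, Prod.norm_def]; simp [max_comm]
      rw [← e1]
      exact (norm_fst_le (g, (h', -h))).trans hy2
    have green := hG _ hx _ hy
    simp only [inner_neg_left, sub_neg_eq_add] at green
    have l1 : ‖⟪g.1, f.2⟫ - ⟪g.2, f.1⟫‖ ≤ 2 * (‖g‖ * ‖f‖) := by
      refine (norm_sub_le _ _).trans ?_
      have a1 := (norm_inner_le_norm (𝕜 := ℂ) g.1 f.2).trans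
        (mul_le_mul (norm_fst_le g) (norm_snd_le f) (norm_nonneg _) (norm_nonneg _))
      have a2 := (norm_inner_le_norm (𝕜 := ℂ) g.2 f.1).trans
        (mul_le_mul (norm_snd_le g) (norm_fst_le f) (norm_nonneg _) (norm_nonneg _))
      linarith
    have l2 : ‖⟪h', h'⟫ + ⟪h, h⟫‖ = ‖h'‖ ^ 2 + ‖h‖ ^ 2 := by
      have e0 : ⟪h', h'⟫ + ⟪h, h⟫ = ((‖h'‖ ^ 2 + ‖h‖ ^ 2 : ℝ) : ℂ) := by
        rw [inner_self_eq_norm_sq_to_K, inner_self_eq_norm_sq_to_K]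
        push_cast
        rfl
      rw [e0, Complex.norm_real, Real.norm_of_nonneg (by positivity)]
    rw [green, l2] at l1
    have l3 : ‖(h, h')‖ ^ 2 ≤ ‖h'‖ ^ 2 + ‖h‖ ^ 2 := by
      rw [Prod.norm_def]
      rcases max_choice ‖h‖ ‖h'‖ with hm | hm <;> simp only [hm] <;> nlinarith [sq_nonneg ‖h‖, sq_nonneg ‖h'‖]
    have l4 : ‖g‖ * ‖f‖ ≤ C * ‖(h, h')‖ * ‖f‖ := mul_le_mul_of_nonneg_right hgn (norm_nonneg _)
    change ‖(h, h')‖ ≤ 2 * C * ‖f‖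
    by_contra hcon
    push Not at hcon
    have hpos : 0 < ‖(h, h')‖ := lt_of_le_of_lt (by positivity) hcon
    nlinarith
  refine ⟨⟨⟨G, rfl⟩, hdom, hG⟩, ?_, ?_, hran⟩
  · ext k
    constructor
    · intro hk
      have := bound ⟨((0 : E × E), k), hk⟩
      simp only [norm_zero, mul_zero] at this
      exact norm_eq_zero.1 (le_antisymm this (norm_nonneg _))
    · rintro rfl
      exact G.zero_mem
  · let Q : G →L[ℂ] (E × E) := (ContinuousLinearMap.fst ℂ (E × E) (F × F)).comp G.subtypeL
    have hanti : AntilipschitzWith (max 1 (2 * C)).toNNReal Q := by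
      refine AddMonoidHomClass.antilipschitz_of_bound Q fun x => ?_
      rw [Real.coe_toNNReal _ (by positivity)]
      have e1 : ‖x‖ = max ‖(x : (E × E) × (F × F)).1‖ ‖(x : (E × E) × (F × F)).2‖ := rfl
      have e2 : Q x = (x : (E × E) × (F × F)).1 := rfl
      rw [e1, e2]
      refine max_le ?_ ((bound x).trans ?_)
      · exact le_mul_of_one_le_left (norm_nonneg _) (le_max_left _ _)
      · exact mul_le_mul_of_nonneg_right (le_max_right _ _) (norm_nonneg _)
    have hc := hanti.isClosed_range Q.uniformContinuous
    have heq : Set.range Q = domR (G : Set ((E × E) × (F × F))) := by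
      ext f
      constructor
      · rintro ⟨x, rfl⟩
        exact ⟨_, x.2⟩
      · rintro ⟨k, hk⟩
        exact ⟨⟨(f, k), hk⟩, rfl⟩
    rw [heq] at hc
    unfold IsDomDense at hD
    rw [← hD, hc.closure_eq]

theorem dom_full_of_closed_ran (G : Submodule ℂ ((E × E) × (F × F)))
    (hG : GreenPair (G : Set ((E × E) × (F × F))))
    (hr : ranR (G0 (G : Set ((E × E) × (F × F)))) = Set.univ)
    (hs : A0 (G : Set ((E × E) × (F × F))) = adjR (A0 (G : Set ((E × E) × (F × F)))))
    (T : Submodule ℂ (F × F)) (hd : Dense (domR (T : Set (F × F))))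
    (hc : IsClosed (ranR (triTransform (G : Set ((E × E) × (F × F))) (T : Set (F × F)))))
    (hb : IsBddRel (T : Set (F × F))) : domR (T : Set (F × F)) = Set.univ := by
  obtain ⟨Φ, hΦ⟩ := gamma_exists G hG hr hs
  obtain ⟨C, hC⟩ := hb
  have hC' : ∀ p ∈ closure (T : Set (F × F)), ‖p.2‖ ≤ C * ‖p.1‖ := by
    have hcl : IsClosed {p : F × F | ‖p.2‖ ≤ C * ‖p.1‖} :=
      isClosed_le (by fun_prop) (by fun_prop)
    exact fun p hp => closure_minimal hC hcl hp
  have hclT : IsClosed (T.topologicalClosure : Set (F × F)) := isClosed_closure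
  haveI : CompleteSpace T.topologicalClosure := hclT.completeSpace_coe
  let Q : T.topologicalClosure →L[ℂ] F :=
    (ContinuousLinearMap.fst ℂ F F).comp T.topologicalClosure.subtypeL
  have hanti : AntilipschitzWith (max 1 C).toNNReal Q := by
    refine AddMonoidHomClass.antilipschitz_of_bound Q fun x => ?_
    rw [Real.coe_toNNReal _ (by positivity)]
    have e1 : ‖x‖ = max ‖(x : F × F).1‖ ‖(x : F × F).2‖ := rfl
    have e2 : Q x = (x : F × F).1 := rfl
    rw [e1, e2]
    refine max_le ?_ ((hC' x x.2).trans ?_)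
    · exact le_mul_of_one_le_left (norm_nonneg _) (le_max_left _ _)
    · exact mul_le_mul_of_nonneg_right (le_max_right _ _) (norm_nonneg _)
  have hcr := hanti.isClosed_range Q.uniformContinuous
  rw [Set.eq_univ_iff_forall]
  intro h
  have hsub : domR (T : Set (F × F)) ⊆ Set.range Q := by
    rintro k ⟨w, hw⟩
    exact ⟨⟨(k, w), subset_closure hw⟩, rfl⟩
  obtain ⟨⟨⟨k, w⟩, hx⟩, hxk⟩ := closure_minimal hsub hcr (hd h)
  have hxk' : k = h := hxk
  subst hxk'
  let φ : F × F → F × F := fun p => (p.1, p.2 + (Φ p.1).2)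
  have hφ : Continuous φ := by fun_prop
  have hmem : φ (k, w) ∈ closure
      (ranR (triTransform (G : Set ((E × E) × (F × F))) (T : Set (F × F)))) := by
    refine map_mem_closure hφ hx ?_
    rintro ⟨a, b⟩ hab
    exact ⟨_, a, _, b, hΦ a, hab, rfl⟩
  rw [hc.closure_eq] at hmem
  obtain ⟨f, a, a', b, -, hb, heq⟩ := hmem
  simp only [φ, Prod.mk.injEq] at heq
  rw [heq.1]
  exact ⟨b, hb⟩

/-- a closed subspace of `F × F` with trivial symplectic complement is everything -/
theorem top_of_krein (R : Submodule ℂ (F × F)) (hc : IsClosed (R : Set (F × F)))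
    (h : ∀ k : F × F, (∀ p ∈ R, ⟪k.1, p.2⟫ - ⟪k.2, p.1⟫ = 0) → k = 0) : R = ⊤ := by
  let W := WithLp.prodContinuousLinearEquiv 2 ℂ F F
  let R' : Submodule ℂ (WithLp 2 (F × F)) :=
    R.comap (W.toLinearEquiv : WithLp 2 (F × F) →ₗ[ℂ] F × F)
  have hc' : IsClosed (R' : Set (WithLp 2 (F × F))) := hc.preimage W.continuous
  haveI : CompleteSpace R' := hc'.completeSpace_coe
  have hbot : R'ᗮ = ⊥ := by
    rw [Submodule.eq_bot_iff]
    intro x hx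
    rw [Submodule.mem_orthogonal'] at hx
    have := h (x.snd, -x.fst) (by
      intro p hp
      have h1 := hx (WithLp.toLp 2 p) hp
      rw [WithLp.prod_inner_apply] at h1
      simp only [inner_neg_left, sub_neg_eq_add]
      rw [add_comm]
      exact h1)
    simp only [Prod.mk_eq_zero, neg_eq_zero] at this
    apply W.injective
    exact Prod.ext this.2 this.1
  rw [Submodule.orthogonal_eq_bot_iff] at hbot
  rw [eq_top_iff]
  intro p _
  have : WithLp.toLp 2 p ∈ R' := by rw [hbot]; trivial
  exact this

theorem ran_full (G : Submodule ℂ ((E × E) × (F × F)))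
    (hG : GreenPair (G : Set ((E × E) × (F × F))))
    (hk : invR (G : Set ((E × E) × (F × F))) = kreinAdj (G : Set ((E × E) × (F × F))))
    (hc : IsClosed (ranR (G : Set ((E × E) × (F × F)))))
    (h0 : ∀ k : F × F, ((0 : E × E), k) ∈ G → k = 0) :
    ranR (G : Set ((E × E) × (F × F))) = Set.univ := by
  let R : Submodule ℂ (F × F) := G.map (LinearMap.snd ℂ (E × E) (F × F))
  have hR : (R : Set (F × F)) = ranR (G : Set ((E × E) × (F × F))) := by
    ext k
    constructor
    · rintro ⟨x, hx, rfl⟩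
      exact ⟨x.1, hx⟩
    · rintro ⟨f, hf⟩
      exact ⟨(f, k), hf, rfl⟩
  have : R = ⊤ := by
    refine top_of_krein R (by rw [hR]; exact hc) fun k hkk => h0 k ?_
    have h1 : (k, (0 : E × E)) ∈ kreinAdj (G : Set ((E × E) × (F × F))) := by
      rw [mem_kreinAdj_iff]
      intro p hp
      have := hkk p.2 ⟨p, hp, rfl⟩
      simp only [Prod.fst_zero, Prod.snd_zero, inner_zero_left, sub_zero]
      exact this.symm
    rw [← hk] at h1
    exact h1
  rw [← hR, this]
  rfl

/-- properties of the transform `Γ̃ = triTransform Γ e` of a B-generalized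
boundary pair by a densely defined symmetric operator `E` (with graph `e`). -/
theorem statement8 (A : Set (E × E)) (Γ : Set ((E × E) × (F × F)))
    (hA : IsClosedSymRel A) (hB : IsBPair A Γ)
    (e : Set (F × F)) (he1 : IsLinRel e) (he2 : Dense (domR e)) (he3 : e ⊆ adjR e) :
    -- (i)
    (IsUnitaryPair A (triTransform Γ e) ↔ e = adjR e) ∧
    -- (ii)
    ((∃ Γ'' : Set ((E × E) × (F × F)), IsUnitaryPair A Γ'' ∧ triTransform Γ e ⊆ Γ'') ↔
        Nonempty ((defectSubmodule e Complex.I) ≃ₗᵢ[ℂ] (defectSubmodule e (-Complex.I)))) ∧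
    ((∃ Γ'' : Set ((E × E) × (F × F)), IsUnitaryPair A Γ'' ∧ triTransform Γ e ⊆ Γ'') →
        ∀ e₀ : Set (F × F), e ⊆ e₀ → e₀ = adjR e₀ →
          IsUnitaryPair A (triTransform Γ e₀) ∧ triTransform Γ e ⊆ triTransform Γ e₀) ∧
    -- (iii)
    (IsBPair A (triTransform Γ e) ↔ (domR e = Set.univ ∧ IsBddRel e)) ∧
    -- (iv)
    (IsOrdinaryBT A (triTransform Γ e) ↔ ranR (triTransform Γ e) = Set.univ) ∧
    (IsOrdinaryBT A (triTransform Γ e) ↔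
       (IsClosed (ranR (triTransform Γ e)) ∧ IsBddRel e ∧
        ∀ l : ℂ, l.im ≠ 0 → ∀ p ∈ weyl (triTransform Γ e) l,
          ⟪p.1, p.2⟫ = ⟪p.2, p.1⟫ → p.1 = 0)) := by
  obtain ⟨G, rfl⟩ := hB.1.1.1
  obtain ⟨T, rfl⟩ := he1
  have hTl : IsLinRel (T : Set (F × F)) := ⟨T, rfl⟩
  have h00 : ((0, 0) : F × F) ∈ (T : Set (F × F)) := T.zero_mem
  have hi := unitary_tri_iff A G hB _ hTl he2 he3
  have hB' := hB
  obtain ⟨⟨⟨-, hdom, hG⟩, hD, -, hs⟩, hr⟩ := hB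
  have hiso : IsIsomPair A (triTransform (G : Set ((E × E) × (F × F))) (T : Set (F × F))) :=
    ⟨tri_linear G T, (tri_dense A G hB' _ he2).1, tri_green _ hG _ he3⟩
  have hext : ∀ e₀ : Set (F × F), (T : Set (F × F)) ⊆ e₀ → e₀ = adjR e₀ →
      IsUnitaryPair A (triTransform (G : Set ((E × E) × (F × F))) e₀) ∧
      triTransform (G : Set ((E × E) × (F × F))) (T : Set (F × F)) ⊆ triTransform G e₀ := by
    intro e₀ h1 h2
    refine ⟨?_, tri_mono _ h1⟩
    refine (unitary_tri_iff A G hB' e₀ ?_ ?_ h2.subset).2 h2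
    · rw [h2]; exact adjR_linear _
    · have hsub : domR (T : Set (F × F)) ⊆ domR e₀ := by
        rintro x ⟨y, hy⟩
        exact ⟨y, h1 hy⟩
      exact he2.mono hsub
  have hiv1 : IsOrdinaryBT A (triTransform (G : Set ((E × E) × (F × F))) (T : Set (F × F))) ↔
      ranR (triTransform (G : Set ((E × E) × (F × F))) (T : Set (F × F))) = Set.univ := by
    refine ⟨fun h => h.2.2.2, fun h => ?_⟩
    have hsa := sa_of_full he3 (ran_tri_dom _ _ h)
    have hu := hi.2 hsa
    obtain ⟨G', hG'⟩ := tri_linear G T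
    rw [← hG'] at hu h ⊢
    exact ordinary_of_ran A G' hu h
  refine ⟨hi, ⟨?_, ?_⟩, fun _ => hext, ⟨?_, ?_⟩, hiv1, ⟨?_, ?_⟩⟩
  · rintro ⟨Γ', hu, hsub⟩
    obtain ⟨e₀, h1, h2⟩ := sa_of_unitary_ext A G hB' _ hTl Γ' hu hsub
    obtain ⟨S, hS⟩ := adjR_linear e₀
    rw [← h2] at hS
    subst hS
    exact defect_of_sa_ext T S h1 h2
  · rintro ⟨V⟩
    obtain ⟨e₀, h1, h2⟩ := sa_ext_of_defect T he3 V
    exact ⟨_, hext e₀ h1 h2⟩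
  · rintro ⟨-, h⟩
    rw [tri_ran0 _ hr] at h
    exact ⟨h, bdd_of_full T he3 h⟩
  · rintro ⟨h, -⟩
    have hran : ranR (G0 (triTransform (G : Set ((E × E) × (F × F))) (T : Set (F × F)))) =
        Set.univ := by rw [tri_ran0 _ hr, h]
    refine ⟨⟨hiso, (tri_dense A G hB' _ he2).2, ?_, ?_⟩, hran⟩
    · rw [hran]; exact dense_univ
    · rw [tri_A0 _ _ h00 he2 he3]; exact hs
  · intro h
    have hran := h.2.2.2
    refine ⟨by rw [hran]; exact isClosed_univ, bdd_of_full T he3 (ran_tri_dom _ _ hran), ?_⟩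
    rintro l hl p ⟨f, hf⟩ hp
    have green := h.1.2.2 _ hf _ hf
    simp only [inner_smul_left, inner_smul_right] at green
    rw [hp, sub_self, ← sub_mul] at green
    have hl' : l - (starRingEnd ℂ) l ≠ 0 := by
      intro h0
      have := congrArg Complex.im h0
      simp at this
      exact hl (by linarith)
    have hf0 : f = 0 := inner_self_eq_zero.1 ((mul_eq_zero.1 green).resolve_left hl')
    subst hf0
    rw [smul_zero] at hf
    have hm : p ∈ mulR (triTransform (G : Set ((E × E) × (F × F))) (T : Set (F × F))) := hf
    rw [h.2.1] at hm
    have hm' : p = 0 := hm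
    rw [hm']; rfl
  · rintro ⟨hc, hb, hcond⟩
    rw [hiv1]
    have hd := dom_full_of_closed_ran G hG hr hs T he2 hc hb
    have hu := hi.2 (sa_of_full he3 hd)
    have hzero : ∀ k : F × F, ((0 : E × E), k) ∈
        triTransform (G : Set ((E × E) × (F × F))) (T : Set (F × F)) → k = 0 := by
      intro k hk
      have green := hu.1 _ hk _ hk
      simp only [Prod.fst_zero, Prod.snd_zero, inner_zero_left, sub_self] at green
      have hk1 : k.1 = 0 := by
        refine hcond Complex.I (by simp) k ⟨0, ?_⟩ (sub_eq_zero.1 green.symm)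
        rw [smul_zero]; exact hk
      obtain ⟨h, h', w, hf, hw, heq⟩ := hk
      simp only at hf heq
      subst heq
      simp only at hk1
      subst hk1
      have hw0 := mul_of_sym he2 (he3 hw)
      have hh0 := mul_zero_of_ran G hG hr hf
      rw [hw0, hh0]; simp
    obtain ⟨G', hG'⟩ := tri_linear G T
    rw [← hG'] at hu hc hzero ⊢
    exact ran_full G' hu.1 hu.2.2.2 hc hzero

end BT
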